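/- Fix n ≥ 1. Then R/(I+J)^i is Cohen–Macaulay for all 1 ≤ i ≤ n if and only if A/I^i and B/J^i are Cohen–Macaulay for all 1 ≤ i ≤ n. -/

import Mathlib

/-! Core definitions: depth via local cohomology at the maximal homogeneous ideal,
Castelnuovo–Mumford regularity via graded free resolutions, gradings on
subquotients of polynomial rings.  -/

open MvPolynomial

noncomputable section

namespace PaperHTT

variable (k : Type) [Field k]

/-- A polynomial is homogeneous of degree `e : ℤ` (it must vanish in negative degrees). -/
def homogZ {σ : Type} (p : MvPolynomial σ k) (e : ℤ) : Prop :=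
  p = 0 ∨ (0 ≤ e ∧ p.IsHomogeneous e.toNat)

/-- The maximal homogeneous ideal `(x_1, …, x_r)` of a polynomial ring. -/
def maxHomIdeal (σ : Type) : Ideal (MvPolynomial σ k) :=
  Ideal.span (Set.range MvPolynomial.X)

/-- The depth of a module over a polynomial ring with respect to the maximal homogeneous
ideal: the least `i` such that the `i`-th local cohomology is non-vanishing. -/
def depthM {σ : Type} (M : ModuleCat (MvPolynomial σ k)) : ℕ :=
  sInf {i : ℕ | Nontrivial ((localCohomology (maxHomIdeal k σ) i).obj M)}

/-- The subquotient `p/q` of a polynomial ring, for ideals `q ≤ p`. -/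
abbrev subQuot {σ : Type} (p q : Ideal (MvPolynomial σ k)) : Type :=
  ↥p ⧸ (Submodule.comap p.subtype q)

/-- The degree-`t` graded piece of `p/q`: the image of the homogeneous elements of
degree `t` of `p`. -/
def subQuotGr {σ : Type} (p q : Ideal (MvPolynomial σ k)) (t : ℤ) :
    AddSubgroup (subQuot k p q) :=
  AddSubgroup.closure
    {x | ∃ f : p, homogZ k (f : MvPolynomial σ k) t ∧ x = Submodule.Quotient.mk f}

/-- The degree-`t` graded piece of the quotient ring `P/Q`. -/
def quotGr {σ : Type} (Q : Ideal (MvPolynomial σ k)) (t : ℤ) :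
    AddSubgroup (MvPolynomial σ k ⧸ Q) :=
  AddSubgroup.closure {x | ∃ f, homogZ k f t ∧ x = Ideal.Quotient.mk Q f}

/-- The degree-`t` graded piece of an ideal `p`, viewed as a module. -/
def idealGr {σ : Type} (p : Ideal (MvPolynomial σ k)) (t : ℤ) : AddSubgroup ↥p :=
  AddSubgroup.closure {x : p | homogZ k (x : MvPolynomial σ k) t}

/-- A finite graded free resolution of a module `M` over a polynomial ring,
with respect to a grading `gr` of `M`: `F_i` is free of rank `rk i`, with basis elements
of (twisted) degrees `tw i l`, the differentials and augmentation are graded of degree `0`,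
and the complex `⋯ → F_1 → F_0 → M → 0` is exact. -/
structure GradedFreeRes (σ : Type) (M : Type) [AddCommGroup M]
    [Module (MvPolynomial σ k) M] (gr : ℤ → AddSubgroup M) where
  rk : ℕ → ℕ
  tw : (i : ℕ) → Fin (rk i) → ℤ
  bdd : ∃ N, ∀ i, N ≤ i → rk i = 0
  aug : (Fin (rk 0) → MvPolynomial σ k) →ₗ[MvPolynomial σ k] M
  d : (i : ℕ) →
    ((Fin (rk (i + 1)) → MvPolynomial σ k) →ₗ[MvPolynomial σ k]
      (Fin (rk i) → MvPolynomial σ k))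
  aug_surj : Function.Surjective aug
  exact_zero : LinearMap.range (d 0) = LinearMap.ker aug
  exact_succ : ∀ i, LinearMap.range (d (i + 1)) = LinearMap.ker (d i)
  aug_homog : ∀ l, aug (Pi.single l 1) ∈ gr (tw 0 l)
  d_homog : ∀ i l l', homogZ k (d i (Pi.single l 1) l') (tw (i + 1) l - tw i l')

/-- The Castelnuovo–Mumford regularity of a (finitely generated) graded module over a
polynomial ring: the least `r` such that `M` admits a graded free resolution with all
twists in homological degree `i` at most `r + i`.  (By minimal free resolutions, this
agrees with `max {aⁱ(M) + i}`.) -/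
def regM (σ : Type) (M : Type) [AddCommGroup M] [Module (MvPolynomial σ k) M]
    (gr : ℤ → AddSubgroup M) : ℤ :=
  sInf {r : ℤ | ∃ F : GradedFreeRes k σ M gr, ∀ i (l : Fin (F.rk i)), F.tw i l - (i : ℤ) ≤ r}

/-- Depth of the quotient ring `P/Q` as a module over `P`. -/
def depthQuot {σ : Type} (Q : Ideal (MvPolynomial σ k)) : ℕ :=
  depthM k (ModuleCat.of (MvPolynomial σ k) (MvPolynomial σ k ⧸ Q))

/-- Depth of the subquotient `p/q` as a module over the polynomial ring. -/
def depthSubQuot {σ : Type} (p q : Ideal (MvPolynomial σ k)) : ℕ :=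
  depthM k (ModuleCat.of (MvPolynomial σ k) (subQuot k p q))

/-- Depth of an ideal `p` as a module over the polynomial ring. -/
def depthIdeal {σ : Type} (p : Ideal (MvPolynomial σ k)) : ℕ :=
  depthM k (ModuleCat.of (MvPolynomial σ k) ↥p)

/-- Regularity of the quotient ring `P/Q`. -/
def regQuot {σ : Type} (Q : Ideal (MvPolynomial σ k)) : ℤ :=
  regM k σ (MvPolynomial σ k ⧸ Q) (quotGr k Q)

/-- Regularity of the subquotient `p/q`. -/
def regSubQuot {σ : Type} (p q : Ideal (MvPolynomial σ k)) : ℤ :=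
  regM k σ (subQuot k p q) (subQuotGr k p q)

/-- Regularity of an ideal `p`, viewed as a graded module. -/
def regIdeal {σ : Type} (p : Ideal (MvPolynomial σ k)) : ℤ :=
  regM k σ (↥p) (idealGr k p)

/-- A homogeneous ideal: one containing all homogeneous components of its elements. -/
def IsHomogeneousIdeal {σ : Type} (I : Ideal (MvPolynomial σ k)) : Prop :=
  ∀ f ∈ I, ∀ m : ℕ, MvPolynomial.homogeneousComponent m f ∈ I

/-- A monomial ideal. -/
def IsMonomialIdeal {σ : Type} (I : Ideal (MvPolynomial σ k)) : Prop :=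
  ∃ S : Set (σ →₀ ℕ), I = Ideal.span ((fun a => MvPolynomial.monomial a (1 : k)) '' S)

/-- A squarefree monomial ideal. -/
def IsSquarefreeMonomialIdeal {σ : Type} (I : Ideal (MvPolynomial σ k)) : Prop :=
  ∃ S : Set (σ →₀ ℕ), (∀ a ∈ S, ∀ x, a x ≤ 1) ∧
    I = Ideal.span ((fun a => MvPolynomial.monomial a (1 : k)) '' S)


/-- The quotient ring `P/Q` is Cohen–Macaulay: its depth equals its Krull dimension. -/
def IsCMQuot {σ : Type} (Q : Ideal (MvPolynomial σ k)) : Prop :=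
  (depthQuot k Q : WithBot (WithTop ℕ)) = ringKrullDim (MvPolynomial σ k ⧸ Q)

/-- An isomorphism of graded modules: a linear isomorphism matching up the gradings. -/
def GradedIso {P : Type} [CommRing P] {M N : Type} [AddCommGroup M] [Module P M]
    [AddCommGroup N] [Module P N] (grM : ℤ → AddSubgroup M) (grN : ℤ → AddSubgroup N) :
    Prop :=
  ∃ e : M ≃ₗ[P] N, ∀ t, (grM t).map e.toLinearMap.toAddMonoidHom = grN t

/-- `gr` is an (internal, ℤ-) grading of the module `M` over a polynomial ring,
compatible with the standard grading of the polynomial ring. -/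
def IsGrading (σ : Type) {M : Type} [AddCommGroup M] [Module (MvPolynomial σ k) M]
    (gr : ℤ → AddSubgroup M) : Prop :=
  DirectSum.IsInternal (fun t : ℤ => gr t) ∧
    ∀ (p : MvPolynomial σ k) (d : ℕ) (t : ℤ) (m : M), p.IsHomogeneous d → m ∈ gr t →
      p • m ∈ gr (t + d)

/-- The polynomial ring `A = k[x_1,…,x_r]`. -/
abbrev PA (r : ℕ) : Type := MvPolynomial (Fin r) k

/-- The polynomial ring `B = k[y_1,…,y_s]`. -/
abbrev PB (s : ℕ) : Type := MvPolynomial (Fin s) k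

/-- The polynomial ring `R = k[x_1,…,x_r,y_1,…,y_s]`. -/
abbrev PR (r s : ℕ) : Type := MvPolynomial (Fin r ⊕ Fin s) k

/-- The extension of an ideal `I ⊆ A` to `R`. -/
def extA {r s : ℕ} (I : Ideal (PA k r)) : Ideal (PR k r s) :=
  I.map (MvPolynomial.rename (Sum.inl : Fin r → Fin r ⊕ Fin s))

/-- The extension of an ideal `J ⊆ B` to `R`. -/
def extB {r s : ℕ} (J : Ideal (PB k s)) : Ideal (PR k r s) :=
  J.map (MvPolynomial.rename (Sum.inr : Fin s → Fin r ⊕ Fin s))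

/-- The ideal `I + J ⊆ R`. -/
def sumIJ {r s : ℕ} (I : Ideal (PA k r)) (J : Ideal (PB k s)) : Ideal (PR k r s) :=
  extA k I + extB k J

end PaperHTT

end

section DepthCriteria

open CategoryTheory Limits

variable {R : Type} [CommRing R]

lemma mono_homologyMap_of_forall {S₁ S₂ : ShortComplex (ModuleCat R)} (φ : S₁ ⟶ S₂)
    (h : ∀ x : S₁.X₂, S₁.g x = 0 → (∃ y, S₂.f y = φ.τ₂ x) → ∃ y, S₁.f y = x) :
    Mono (ShortComplex.homologyMap φ) := by
  rw [ModuleCat.mono_iff_injective, injective_iff_map_eq_zero]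
  intro z hz
  obtain ⟨c, rfl⟩ := (ModuleCat.epi_iff_surjective S₁.homologyπ).1 inferInstance z
  have e₁ : S₂.homologyπ (ShortComplex.cyclesMap φ c) = 0 := by
    rw [← hz]
    exact (congr($(ShortComplex.homologyπ_naturality φ) c)).symm
  have ex : (ShortComplex.mk S₂.toCycles S₂.homologyπ (by simp)).Exact :=
    ShortComplex.exact_of_g_is_cokernel _ S₂.homologyIsCokernel
  obtain ⟨y, hy⟩ := (ShortComplex.moduleCat_exact_iff _).1 ex _ e₁
  have hy' : S₂.toCycles y = ShortComplex.cyclesMap φ c := hy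
  obtain ⟨y', hy'⟩ := h (S₁.iCycles c) congr($(S₁.iCycles_g) c) ⟨y, by
    have h1 := congr($(S₂.toCycles_i) y)
    have h2 := congr($(ShortComplex.cyclesMap_i φ) c)
    simp only [ModuleCat.hom_comp, LinearMap.comp_apply] at h1 h2
    rw [← h1, hy', h2]⟩
  have : S₁.toCycles y' = c := by
    apply (ModuleCat.mono_iff_injective S₁.iCycles).1 inferInstance
    rw [← hy']
    exact congr($(S₁.toCycles_i) y')
  rw [← this]
  exact congr($(S₁.toCycles_comp_homologyπ) y')

lemma epi_homologyMap_opMap {C : Type*} [Category C] [Abelian C]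
    {S₁ S₂ : ShortComplex C} (φ : S₁ ⟶ S₂) [Mono (ShortComplex.homologyMap φ)] :
    Epi (ShortComplex.homologyMap (ShortComplex.opMap φ)) := by
  have e : ShortComplex.homologyMap (ShortComplex.opMap φ) =
      S₂.homologyOpIso.hom ≫ (ShortComplex.homologyMap φ).op ≫ S₁.homologyOpIso.inv := by
    rw [ShortComplex.homologyMap_op]
    simp
  rw [e]
  infer_instance

lemma epi_homologyMap_of_mono_unopMap {C : Type*} [Category C] [Abelian C]
    {S₁ S₂ : ShortComplex Cᵒᵖ} (φ : S₁ ⟶ S₂)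
    [Mono (ShortComplex.homologyMap (ShortComplex.unopMap φ))] :
    Epi (ShortComplex.homologyMap φ) :=
  epi_homologyMap_opMap (ShortComplex.unopMap φ)

open Abelian
variable {X X' Y : ModuleCat R}

lemma exists_comp_of_extMk_eq_zero (P : ProjectiveResolution X) {n : ℕ} (f : P.complex.X n ⟶ Y)
    (m : ℕ) (hm : n + 1 = m) (hf : P.complex.d m n ≫ f = 0) (h0 : P.extMk f m hm hf = 0)
    (p : ℕ) (hp : p + 1 = n ∨ (n = 0 ∧ p = 0)) :
    ∃ g : P.complex.X p ⟶ Y, P.complex.d n p ≫ g = f := by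
  rcases hp with hp | ⟨rfl, rfl⟩
  · exact (P.extMk_eq_zero_iff f m hm hf p hp).1 h0
  · refine ⟨0, ?_⟩
    rw [← P.extEquivCohomologyClass.apply_eq_iff_eq,
      ProjectiveResolution.extEquivCohomologyClass_extMk,
      ProjectiveResolution.extEquivCohomologyClass_zero,
      CochainComplex.HomComplex.CohomologyClass.mk_eq_zero_iff,
      CochainComplex.HomComplex.Cocycle.toSingleMk_mem_coboundaries_iff _ _ _ _ _ 1 (by lia)] at h0
    obtain ⟨g, hg⟩ := h0
    have : g = 0 := (CochainComplex.isZero_of_isStrictlyLE P.cochainComplex 0 1).eq_of_src _ _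
    rw [this, comp_zero] at hg
    rw [comp_zero, ← cancel_epi (P.cochainComplexXIso (-(0:ℕ)) 0 rfl).hom, ← hg, comp_zero]

lemma isZero_functorExt (n : ℕ) (h : Subsingleton (Ext X Y n)) :
    IsZero (((_root_.Ext R (ModuleCat R) n).obj (Opposite.op X)).obj Y) := by
  obtain ⟨P⟩ := HasProjectiveResolution.out (Z := X)
  refine IsZero.of_iso ?_ (P.isoExt n Y)
  rw [← HomologicalComplex.exactAt_iff_isZero_homology, HomologicalComplex.exactAt_iff,
    ShortComplex.moduleCat_exact_iff]
  intro f hf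
  exact exists_comp_of_extMk_eq_zero P (Y := Y) f ((ComplexShape.up ℕ).next n) (by simp) hf
    (Subsingleton.elim _ _) _ (by cases n <;> simp)

lemma exists_comp_of_hom_comp (f : X' ⟶ X) {n : ℕ}
    (h : Function.Injective fun x : Ext X Y n => (Ext.mk₀ f).comp x (zero_add n))
    {P : ProjectiveResolution X} {P' : ProjectiveResolution X'}
    (φ : ProjectiveResolution.Hom P' P f)
    (x : P.complex.X n ⟶ Y) (m : ℕ) (hm : n + 1 = m) (hx : P.complex.d m n ≫ x = 0)
    (p : ℕ) (hp : p + 1 = n ∨ (n = 0 ∧ p = 0)) (y : P'.complex.X p ⟶ Y)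
    (hy : P'.complex.d n p ≫ y = φ.hom.f n ≫ x) :
    ∃ g : P.complex.X p ⟶ Y, P.complex.d n p ≫ g = x := by
  refine exists_comp_of_extMk_eq_zero P x m hm hx (h ?_) p hp
  change (Ext.mk₀ f).comp _ _ = (Ext.mk₀ f).comp 0 _
  rw [Ext.comp_zero, ProjectiveResolution.mk₀_comp_extMk _ _ _ _ φ]
  simp only [← hy]
  rcases hp with hp | ⟨rfl, rfl⟩
  · exact (P'.extMk_eq_zero_iff _ m hm _ p hp).2 ⟨y, rfl⟩
  · simp

lemma mono_functorExt_map (f : X' ⟶ X) (n : ℕ)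
    (h : Function.Injective fun x : Ext X Y n => (Ext.mk₀ f).comp x (zero_add n)) :
    Mono (((_root_.Ext R (ModuleCat R) n).map f.op).app Y) := by
  obtain ⟨P⟩ := HasProjectiveResolution.out (Z := X)
  obtain ⟨P'⟩ := HasProjectiveResolution.out (Z := X')
  let F := (((linearYoneda R (ModuleCat R)).obj Y).rightOp)
  change Mono ((F.leftDerived n).map f).unop
  have w : ProjectiveResolution.lift f P' P ≫ P.π = P'.π ≫ (ChainComplex.single₀ _).map f :=
    ProjectiveResolution.lift_commutes f P' P
  rw [F.leftDerived_map_eq n f (ProjectiveResolution.lift f P' P) w]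
  let φ : ProjectiveResolution.Hom P' P f := ⟨ProjectiveResolution.lift f P' P, by
    rw [← HomologicalComplex.comp_f, w, HomologicalComplex.comp_f]⟩
  let ψ := (F.mapHomologicalComplex (ComplexShape.down ℕ)).map (ProjectiveResolution.lift f P' P)
  have key : Mono (ShortComplex.homologyMap (ShortComplex.unopMap
      ((HomologicalComplex.shortComplexFunctor _ _ n).map ψ))) := by
    apply mono_homologyMap_of_forall
    intro x hx hy
    obtain ⟨y, hy⟩ := hy
    have hx0 : P.complex.d _ _ ≫ (show P.complex.X n ⟶ Y from x) = 0 := hx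
    exact exists_comp_of_hom_comp f h φ x _ (by simp) hx0 _ (by cases n <;> simp) y hy
  have : Epi ((F.mapHomologicalComplex _ ⋙ HomologicalComplex.homologyFunctor _ _ n).map
      (ProjectiveResolution.lift f P' P)) := epi_homologyMap_of_mono_unopMap _
  infer_instance

lemma subsingleton_ext_of_isZero_functorExt (n : ℕ)
    (h : IsZero (((_root_.Ext R (ModuleCat R) n).obj (Opposite.op X)).obj Y)) :
    Subsingleton (Ext X Y n) := by
  obtain ⟨P⟩ := HasProjectiveResolution.out (Z := X)
  have h' := h.of_iso (P.isoExt n Y).symm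
  rw [← HomologicalComplex.exactAt_iff_isZero_homology, HomologicalComplex.exactAt_iff,
    ShortComplex.moduleCat_exact_iff] at h'
  refine subsingleton_of_forall_eq 0 fun x => ?_
  obtain ⟨f, hf, rfl⟩ := P.extMk_surjective x ((ComplexShape.up ℕ).next n) (by simp)
  obtain ⟨y, hy⟩ := h' f hf
  cases n with
  | succ n =>
    exact (P.extMk_eq_zero_iff f _ _ hf _ (by simp)).2 ⟨y, hy⟩
  | zero =>
    have hy' : P.complex.d 0 ((ComplexShape.up ℕ).prev 0) ≫ (show _ ⟶ Y from y) = f := hy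
    have : f = 0 := by
      rw [← hy', P.complex.shape _ _ (by simp), zero_comp]
    subst this
    simp

lemma subsingleton_ext_of_subsingleton [Subsingleton X] (n : ℕ) : Subsingleton (Ext X Y n) := by
  refine subsingleton_of_forall_eq 0 fun x => ?_
  have : 𝟙 X = 0 := (ModuleCat.isZero_of_subsingleton X).eq_of_src _ _
  rw [← Ext.mk₀_id_comp x, this, Ext.mk₀_zero, Ext.zero_comp]

/-- `M` has depth at least `n` along `m`: the modules `Ext^i(N, M)`, `i < n`, vanish for every
finitely generated `N` supported in `V(m)`. -/
def DepthGE (m : Ideal R) (M : Type) [AddCommGroup M] [Module R M] (n : ℕ) : Prop :=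
  ∀ N : ModuleCat R, Module.Finite R N → Module.support R N ⊆ PrimeSpectrum.zeroLocus m →
    ∀ i < n, Subsingleton (Ext N (ModuleCat.of R M) i)

lemma injective_precomp_of_surjective [IsNoetherianRing R] (m : Ideal R)
    {M : Type} [AddCommGroup M] [Module R M] {g : ℕ} (hM : DepthGE m M g)
    (f : X' ⟶ X) (hf : Function.Surjective f) [Module.Finite R X']
    (hX : Module.support R X' ⊆ PrimeSpectrum.zeroLocus m) :
    Function.Injective
      fun x : Ext X (ModuleCat.of R M) g => (Ext.mk₀ f).comp x (zero_add g) := by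
  have : Epi f := (ModuleCat.epi_iff_surjective f).2 hf
  let S : ShortComplex (ModuleCat R) :=
    ShortComplex.mk (ModuleCat.ofHom (LinearMap.ker f.hom).subtype) f (by ext x; exact x.2)
  have hS : S.ShortExact := by
    have : Mono S.f := (ModuleCat.mono_iff_injective _).2 (Submodule.subtype_injective _)
    have : Epi S.g := ‹Epi f›
    refine ⟨?_⟩
    rw [ShortComplex.moduleCat_exact_iff]
    exact fun x hx => ⟨⟨x, hx⟩, rfl⟩
  rcases g with - | g
  · exact Ext.precomp_mk₀_injective_of_epi _ f
  · change Function.Injective ((Ext.mk₀ f).precomp (ModuleCat.of R M) (zero_add (g + 1)))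
    rw [injective_iff_map_eq_zero]
    intro x hx
    obtain ⟨y, rfl⟩ := Ext.contravariant_sequence_exact₃ hS (ModuleCat.of R M) x hx (add_comm 1 g)
    have := hM S.X₁ (inferInstanceAs (Module.Finite R (LinearMap.ker f.hom)))
      ((Module.support_subset_of_injective (LinearMap.ker f.hom).subtype
        (Submodule.subtype_injective _)).trans hX) g g.lt_succ_self
    rw [Subsingleton.elim y 0, Ext.comp_zero]

lemma support_quotient_pow_subset (m : Ideal R) (t : ℕ) :
    Module.support R (R ⧸ m ^ t) ⊆ PrimeSpectrum.zeroLocus m := by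
  rw [Module.support_eq_zeroLocus, Ideal.annihilator_quotient]
  intro p hp
  exact Ideal.IsPrime.le_of_pow_le (n := t) hp

/-- Local cohomology vanishes below the depth. -/
lemma isZero_localCohomology [IsNoetherianRing R] (m : Ideal R)
    {M : Type} [AddCommGroup M] [Module R M] {g : ℕ} (hM : DepthGE m M g) (i : ℕ) (hi : i < g) :
    IsZero ((localCohomology m i).obj (ModuleCat.of R M)) := by
  refine IsZero.of_iso ?_ (colimitObjIsoColimitCompEvaluation
    (localCohomology.diagram (localCohomology.idealPowersDiagram m) i) (ModuleCat.of R M))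
  rw [IsZero.iff_id_eq_zero]
  refine colimit.hom_ext fun j => IsZero.eq_of_src ?_ _ _
  exact isZero_functorExt i (hM _ (inferInstanceAs (Module.Finite R (R ⧸ m ^ _)))
    (support_quotient_pow_subset m _) i hi)

lemma depthGE_succ_of_subsingleton [IsNoetherianRing R] (m : Ideal R)
    {M : Type} [AddCommGroup M] [Module R M] [Module.Finite R M]
    (hlt : m • (⊤ : Submodule R M) < ⊤) {g : ℕ} (hM : DepthGE m M g)
    (h : Subsingleton (Ext (ModuleCat.of R (R ⧸ m)) (ModuleCat.of R M) g)) :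
    DepthGE m M (g + 1) := by
  have hm : m ≠ ⊤ := by
    rintro rfl
    simp at hlt
  have hs : Module.support R (R ⧸ m) = PrimeSpectrum.zeroLocus m := by
    rw [Module.support_eq_zeroLocus, Ideal.annihilator_quotient]
  have tfae := (ModuleCat.exists_isRegular_tfae m (g + 1) (ModuleCat.of R M) hlt).out 2 0
  have := tfae.1
    ⟨ModuleCat.of R (R ⧸ m), Ideal.Quotient.nontrivial_iff.2 hm,
      inferInstanceAs (Module.Finite R (R ⧸ m)), hs, fun i hi => by
      rcases (Nat.lt_succ_iff_lt_or_eq.1 hi) with hi | rfl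
      · exact hM _ (inferInstanceAs (Module.Finite R (R ⧸ m))) hs.le i hi
      · exact h⟩
  intro N hN hsupp i hi
  rcases subsingleton_or_nontrivial N with h0 | h0
  · exact subsingleton_ext_of_subsingleton i
  · exact this N h0 hN hsupp i hi

/-- Local cohomology is nonzero in degree equal to the depth. -/
lemma nontrivial_localCohomology [IsNoetherianRing R] (m : Ideal R)
    {M : Type} [AddCommGroup M] [Module R M] [Module.Finite R M]
    (hlt : m • (⊤ : Submodule R M) < ⊤) {g : ℕ} (hM : DepthGE m M g) (hM' : ¬ DepthGE m M (g + 1)) :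
    Nontrivial ((localCohomology m g).obj (ModuleCat.of R M)) := by
  by_contra hn
  rw [not_nontrivial_iff_subsingleton] at hn
  let F := localCohomology.diagram (localCohomology.idealPowersDiagram m) g ⋙
    (evaluation _ _).obj (ModuleCat.of R M)
  have hz : IsZero (colimit F) :=
    (@ModuleCat.isZero_of_subsingleton _ _ _ hn).of_iso (colimitObjIsoColimitCompEvaluation
      (localCohomology.diagram (localCohomology.idealPowersDiagram m) g) (ModuleCat.of R M)).symm
  have hmono : ∀ (j j' : ℕᵒᵖᵒᵖ) (φ : j ⟶ j'), Mono (F.map φ) := by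
    intro j j' φ
    have : Module.Finite R
        ((localCohomology.ringModIdeals (localCohomology.idealPowersDiagram m)).obj j'.unop) :=
      inferInstanceAs (Module.Finite R (R ⧸ m ^ _))
    refine mono_functorExt_map _ g (injective_precomp_of_surjective m hM _ ?_
      (support_quotient_pow_subset m _))
    intro x
    obtain ⟨x, rfl⟩ := Submodule.Quotient.mk_surjective _ x
    exact ⟨Submodule.Quotient.mk x, rfl⟩
  have : (colim : (Under (Opposite.op (Opposite.op 1) : ℕᵒᵖᵒᵖ) ⥤ ModuleCat R) ⥤
      _).PreservesMonomorphisms :=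
    inferInstance
  have := IsColimit.mono_ι_app_of_isFiltered (colimit.isColimit F) (Opposite.op (Opposite.op 1))
  have hz' : IsZero (F.obj (Opposite.op (Opposite.op 1))) := 
    IsZero.of_mono ((colimit.cocone F).ι.app (Opposite.op (Opposite.op 1))) hz
  have hs := subsingleton_ext_of_isZero_functorExt g hz'
  refine hM' (depthGE_succ_of_subsingleton m hlt hM ?_)
  have e : (localCohomology.idealPowersDiagram m).obj (Opposite.op 1) = m := pow_one m
  change Subsingleton (Ext (ModuleCat.of R (R ⧸ m ^ 1)) _ g) at hs
  rwa [pow_one] at hs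

lemma sInf_nontrivial_localCohomology [IsNoetherianRing R] (m : Ideal R)
    {M : Type} [AddCommGroup M] [Module R M] [Module.Finite R M]
    (hlt : m • (⊤ : Submodule R M) < ⊤) {g : ℕ} (hM : DepthGE m M g) (hM' : ¬ DepthGE m M (g + 1)) :
    sInf {i : ℕ | Nontrivial ((localCohomology m i).obj (ModuleCat.of R M))} = g := by
  refine le_antisymm (Nat.sInf_le (nontrivial_localCohomology m hlt hM hM')) ?_
  refine le_csInf ⟨g, nontrivial_localCohomology m hlt hM hM'⟩ fun i hi => ?_
  by_contra! hlt
  have := ModuleCat.subsingleton_of_isZero (isZero_localCohomology m hM i hlt)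
  exact not_nontrivial _ hi

section DepthGE

variable {m : Ideal R} {M M' M'' : Type} [AddCommGroup M] [Module R M] [AddCommGroup M']
  [Module R M'] [AddCommGroup M''] [Module R M'']

lemma DepthGE.mono {n n' : ℕ} (h : DepthGE m M n) (hn : n' ≤ n) : DepthGE m M n' :=
  fun N hN hs i hi => h N hN hs i (hi.trans_le hn)

lemma depthGE_zero : DepthGE m M 0 := fun _ _ _ _ hi => absurd hi (Nat.not_lt_zero _)

lemma DepthGE.of_retract {n : ℕ} (h : DepthGE m M n) (i : M' →ₗ[R] M) (p : M →ₗ[R] M')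
    (hip : p ∘ₗ i = LinearMap.id) : DepthGE m M' n := by
  intro N hN hs j hj
  have := h N hN hs j hj
  refine subsingleton_of_forall_eq 0 fun x => ?_
  have e : ModuleCat.ofHom i ≫ ModuleCat.ofHom p = 𝟙 _ := by
    rw [← ModuleCat.ofHom_comp, hip, ModuleCat.ofHom_id]
  rw [← Ext.comp_mk₀_id x, ← e, ← Ext.mk₀_comp_mk₀, ← Ext.comp_assoc_of_second_deg_zero,
    Subsingleton.elim (x.comp (Ext.mk₀ (ModuleCat.ofHom i)) (add_zero j)) 0, Ext.zero_comp]

lemma shortExact_ofHom {f : M' →ₗ[R] M} {g : M →ₗ[R] M''} (hf : Function.Injective f)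
    (hg : Function.Surjective g) (hfg : Function.Exact f g) :
    (ShortComplex.mk (ModuleCat.ofHom f) (ModuleCat.ofHom g)
      (by ext x; exact hfg.apply_apply_eq_zero x)).ShortExact := by
  have := (ModuleCat.mono_iff_injective (ModuleCat.ofHom f)).2 hf
  have := (ModuleCat.epi_iff_surjective (ModuleCat.ofHom g)).2 hg
  refine ⟨?_⟩
  rw [ShortComplex.moduleCat_exact_iff]
  exact fun x hx => (hfg x).1 hx

variable {f : M' →ₗ[R] M} {g : M →ₗ[R] M''} {n : ℕ}

lemma DepthGE.middle (hf : Function.Injective f) (hg : Function.Surjective g)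
    (hfg : Function.Exact f g) (h' : DepthGE m M' n) (h'' : DepthGE m M'' n) : DepthGE m M n := by
  intro N hN hs j hj
  have := h' N hN hs j hj
  have := h'' N hN hs j hj
  refine subsingleton_of_forall_eq 0 fun x => ?_
  obtain ⟨y, rfl⟩ := Ext.covariant_sequence_exact₂ N (shortExact_ofHom hf hg hfg) x
    (Subsingleton.elim (α := Ext N (ModuleCat.of R M'') j) _ _)
  exact (congrArg (fun t : Ext N (ModuleCat.of R M') j => t.comp _ (add_zero j))
    (Subsingleton.elim y 0)).trans (Ext.zero_comp ..)

lemma DepthGE.left (hf : Function.Injective f) (hg : Function.Surjective g)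
    (hfg : Function.Exact f g) (h : DepthGE m M (n + 1)) (h'' : DepthGE m M'' n) :
    DepthGE m M' (n + 1) := by
  intro N hN hs j hj
  have := h N hN hs j hj
  refine subsingleton_of_forall_eq 0 fun x => ?_
  rcases j with - | j
  · have := (ModuleCat.mono_iff_injective (ModuleCat.ofHom f)).2 hf
    exact Ext.postcomp_mk₀_injective_of_mono N (ModuleCat.ofHom f)
      (Subsingleton.elim (α := Ext N (ModuleCat.of R M) 0) _ _)
  · have := h'' N hN hs j (by lia)
    obtain ⟨y, rfl⟩ := Ext.covariant_sequence_exact₁ N (shortExact_ofHom hf hg hfg) x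
      (Subsingleton.elim (α := Ext N (ModuleCat.of R M) (j + 1)) _ _) rfl
    exact (congrArg (fun t : Ext N (ModuleCat.of R M'') j => t.comp _ rfl)
      (Subsingleton.elim y 0)).trans (Ext.zero_comp ..)

lemma DepthGE.right (hf : Function.Injective f) (hg : Function.Surjective g)
    (hfg : Function.Exact f g) (h : DepthGE m M n) (h' : DepthGE m M' (n + 1)) :
    DepthGE m M'' n := by
  intro N hN hs j hj
  have := h N hN hs j hj
  have := h' N hN hs (j + 1) (by lia)
  refine subsingleton_of_forall_eq 0 fun x => ?_
  obtain ⟨y, rfl⟩ := Ext.covariant_sequence_exact₃ N (shortExact_ofHom hf hg hfg) x rfl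
    (Subsingleton.elim (α := Ext N (ModuleCat.of R M') (j + 1)) _ _)
  exact (congrArg (fun t : Ext N (ModuleCat.of R M) j => t.comp _ (add_zero j))
    (Subsingleton.elim y 0)).trans (Ext.zero_comp ..)

lemma DepthGE.of_regular (hg : Function.Surjective g) {x : R} (hx : x ∈ m)
    (hreg : IsSMulRegular M x) (hxg : Function.Exact (x • (LinearMap.id : M →ₗ[R] M)) g)
    (h : DepthGE m M'' n) :
    DepthGE m M (n + 1) := by
  intro N hN hs j hj
  have hinj : Function.Injective (x • (LinearMap.id : M →ₗ[R] M)) := hreg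
  have key : ∀ a : Ext N (ModuleCat.of R M) j, x • a = 0 → a = 0 := by
    intro a ha
    have ha' : a.comp (Ext.mk₀ (ModuleCat.ofHom (x • (LinearMap.id : M →ₗ[R] M)))) (add_zero j)
        = 0 := by
      rw [← ha]
      change a.comp (Ext.mk₀ (x • 𝟙 (ModuleCat.of R M))) _ = _
      rw [Ext.mk₀_smul, Ext.comp_smul, Ext.comp_mk₀_id]
    rcases j with - | j
    · have := (ModuleCat.mono_iff_injective (ModuleCat.ofHom (x • (LinearMap.id : M →ₗ[R] M)))).2
        hinj
      exact Ext.postcomp_mk₀_injective_of_mono N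
        (ModuleCat.ofHom (x • (LinearMap.id : M →ₗ[R] M))) (ha'.trans (map_zero _).symm)
    · have := h N hN hs j (by lia)
      obtain ⟨y, rfl⟩ := Ext.covariant_sequence_exact₁ N (shortExact_ofHom hinj hg hxg) a ha' rfl
      exact (congrArg (fun t : Ext N (ModuleCat.of R M'') j => t.comp _ rfl)
        (Subsingleton.elim y 0)).trans (Ext.zero_comp ..)
  rw [Module.support_eq_zeroLocus, PrimeSpectrum.zeroLocus_subset_zeroLocus_iff] at hs
  obtain ⟨t, ht⟩ := hs hx
  refine subsingleton_of_forall_eq 0 fun a => ?_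
  have hpow : x ^ t • a = 0 := by
    rw [← Ext.mk₀_id_comp a, ← Ext.smul_comp, ← Ext.mk₀_smul]
    have : x ^ t • 𝟙 N = 0 := by
      ext y
      exact Module.mem_annihilator.1 ht y
    rw [this, Ext.mk₀_zero, Ext.zero_comp]
  clear ht
  induction t with
  | zero => simpa using hpow
  | succ t ih => exact ih (key _ (by rwa [smul_smul, ← pow_succ']))

end DepthGE

section Cyclic

lemma smul_top_quotient_lt_top {m Q : Ideal R} (hm : m ≠ ⊤) (hQ : Q ≤ m) :
    m • (⊤ : Submodule R (R ⧸ Q)) < ⊤ := by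
  rw [lt_top_iff_ne_top]
  intro h
  have h1 : Submodule.map (Submodule.mkQ Q) m = ⊤ := by
    rw [← h, ← Submodule.range_mkQ Q, LinearMap.range_eq_map, ← Submodule.map_smul'',
      smul_eq_mul, Ideal.mul_top]
  have h2 : Submodule.mkQ Q 1 ∈ Submodule.map (Submodule.mkQ Q) m := h1 ▸ Submodule.mem_top
  obtain ⟨a, ha, hab⟩ := h2
  rw [Submodule.mkQ_apply, Submodule.mkQ_apply, Submodule.Quotient.eq] at hab
  exact hm ((Ideal.eq_top_iff_one m).2 (by simpa using m.sub_mem ha (hQ hab)))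

lemma exists_isSMulRegular_of_depthGE [IsNoetherianRing R] {m : Ideal R} {M : Type}
    [AddCommGroup M] [Module R M] [Module.Finite R M] {n : ℕ} (h : DepthGE m M (n + 1)) :
    ∃ x ∈ m, IsSMulRegular M x := by
  have hs : Module.support R (R ⧸ m) ⊆ PrimeSpectrum.zeroLocus m := by
    rw [Module.support_eq_zeroLocus, Ideal.annihilator_quotient]
  have := h (ModuleCat.of R (R ⧸ m)) (inferInstanceAs (Module.Finite R (R ⧸ m))) hs 0 n.succ_pos
  have : Subsingleton ((R ⧸ m) →ₗ[R] M) :=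
    (Ext.addEquiv₀.trans (ModuleCat.homAddEquiv (M := ModuleCat.of R (R ⧸ m))
      (N := ModuleCat.of R M))).symm.subsingleton
  obtain ⟨x, hx, hreg⟩ := IsSMulRegular.subsingleton_linearMap_iff.1 this
  exact ⟨x, by rwa [Ideal.annihilator_quotient] at hx, hreg⟩

lemma not_depthGE_one_iff [IsNoetherianRing R] {m Q : Ideal R} (hm : m ≠ ⊤) (hQ : Q ≤ m) :
    ¬ DepthGE m (R ⧸ Q) 1 ↔ ∃ u ∉ Q, ∀ x ∈ m, x * u ∈ Q := by
  constructor
  · intro h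
    by_contra! h'
    refine h (depthGE_succ_of_subsingleton m (smul_top_quotient_lt_top hm hQ) depthGE_zero ?_)
    have : Subsingleton ((R ⧸ m) →ₗ[R] (R ⧸ Q)) := by
      refine subsingleton_of_forall_eq 0 fun φ => ?_
      obtain ⟨u, hu⟩ := Ideal.Quotient.mk_surjective (φ 1)
      have hu0 : φ 1 = 0 := by
        rw [← hu, Ideal.Quotient.eq_zero_iff_mem]
        by_contra hu'
        obtain ⟨x, hx, hxu⟩ := h' u hu'
        refine hxu (Ideal.Quotient.eq_zero_iff_mem.1 ?_)
        rw [map_mul, hu, ← smul_eq_mul, ← Ideal.Quotient.algebraMap_eq, algebraMap_smul,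
          ← map_smul, ← algebraMap_smul (R ⧸ m), Ideal.Quotient.algebraMap_eq,
          Ideal.Quotient.eq_zero_iff_mem.2 hx, zero_smul, map_zero]
      refine Submodule.linearMap_qext _ (LinearMap.ext_ring ?_)
      exact hu0
    exact (Ext.addEquiv₀.trans ModuleCat.homAddEquiv).subsingleton
  · rintro ⟨u, hu, hmu⟩ h
    obtain ⟨x, hx, hreg⟩ := exists_isSMulRegular_of_depthGE h
    refine hu (Ideal.Quotient.eq_zero_iff_mem.1 (hreg ?_))
    change x • Ideal.Quotient.mk Q u = x • 0
    rw [smul_zero]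
    exact Ideal.Quotient.eq_zero_iff_mem.2 (hmu x hx)

variable {m Q : Ideal R} {x : R}

lemma isSMulRegular_quotient_iff :
    IsSMulRegular (R ⧸ Q) x ↔ ∀ a, x * a ∈ Q → a ∈ Q := by
  rw [isSMulRegular_iff_right_eq_zero_of_smul]
  constructor
  · intro h a ha
    exact Ideal.Quotient.eq_zero_iff_mem.1 (h (Ideal.Quotient.mk Q a)
      (Ideal.Quotient.eq_zero_iff_mem.2 ha))
  · intro h a ha
    obtain ⟨a, rfl⟩ := Ideal.Quotient.mk_surjective a
    exact Ideal.Quotient.eq_zero_iff_mem.2 (h a (Ideal.Quotient.eq_zero_iff_mem.1 ha))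

lemma exact_smul_factor : Function.Exact (x • (LinearMap.id : R ⧸ Q →ₗ[R] R ⧸ Q))
    (Submodule.factor (le_sup_left : Q ≤ Q ⊔ Ideal.span {x})) := by
  intro a
  obtain ⟨a, rfl⟩ := Submodule.Quotient.mk_surjective _ a
  rw [← Submodule.mkQ_apply, Submodule.factor_mk, Submodule.mkQ_apply, Submodule.mkQ_apply,
    Submodule.Quotient.mk_eq_zero]
  constructor
  · intro ha
    obtain ⟨q, hq, y, hy, rfl⟩ := Submodule.mem_sup.1 ha
    obtain ⟨c, rfl⟩ := Ideal.mem_span_singleton'.1 hy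
    refine ⟨Submodule.Quotient.mk c, ?_⟩
    rw [LinearMap.smul_apply, LinearMap.id_apply, ← Submodule.Quotient.mk_smul,
      Submodule.Quotient.eq]
    simpa [mul_comm] using hq
  · rintro ⟨b, hb⟩
    obtain ⟨b, rfl⟩ := Submodule.Quotient.mk_surjective _ b
    rw [LinearMap.smul_apply, LinearMap.id_apply, ← Submodule.Quotient.mk_smul,
      Submodule.Quotient.eq] at hb
    have : a = x * b - (x • b - a) := by simp
    rw [this]
    exact sub_mem (Ideal.mem_sup_right (Ideal.mul_mem_right _ _ (Ideal.mem_span_singleton_self x)))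
      (Ideal.mem_sup_left hb)

lemma depthGE_sup_span_of_regular {n : ℕ} (hreg : IsSMulRegular (R ⧸ Q) x)
    (h : DepthGE m (R ⧸ Q) (n + 1)) : DepthGE m (R ⧸ (Q ⊔ Ideal.span {x})) n :=
  DepthGE.right (f := x • (LinearMap.id : R ⧸ Q →ₗ[R] R ⧸ Q)) hreg
    (Submodule.factor_surjective _) exact_smul_factor (h.mono n.le_succ) h

lemma depthGE_succ_iff_of_regular {n : ℕ} (hx : x ∈ m) (hreg : IsSMulRegular (R ⧸ Q) x) :
    DepthGE m (R ⧸ Q) (n + 1) ↔ DepthGE m (R ⧸ (Q ⊔ Ideal.span {x})) n :=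
  ⟨depthGE_sup_span_of_regular hreg, fun h => DepthGE.of_regular
    (Submodule.factor_surjective _) hx hreg exact_smul_factor h⟩

lemma ringKrullDim_sup_span_add_one_le (hreg : IsSMulRegular (R ⧸ Q) x) :
    ringKrullDim (R ⧸ (Q ⊔ Ideal.span {x})) + 1 ≤ ringKrullDim (R ⧸ Q) := by
  refine ringKrullDim_succ_le_of_surjective (Ideal.Quotient.factor le_sup_left)
    (Ideal.Quotient.factor_surjective _) (r := Ideal.Quotient.mk Q x) ?_ ?_
  · rw [mem_nonZeroDivisors_iff_right]
    intro a ha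
    refine hreg ?_
    change x • a = x • 0
    rw [smul_zero, ← ha, mul_comm, ← smul_eq_mul, ← Ideal.Quotient.algebraMap_eq, algebraMap_smul]
  · rw [Ideal.Quotient.factor_mk, Ideal.Quotient.eq_zero_iff_mem]
    exact Ideal.mem_sup_right (Ideal.mem_span_singleton_self x)

/-- Depth is at most dimension. -/
lemma depthGE_le_ringKrullDim [IsNoetherianRing R] (hm : m ≠ ⊤) (hQ : Q ≤ m) {n : ℕ}
    (h : DepthGE m (R ⧸ Q) n) : (n : WithBot ℕ∞) ≤ ringKrullDim (R ⧸ Q) := by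
  induction n generalizing Q with
  | zero =>
    have : Nontrivial (R ⧸ Q) :=
      Ideal.Quotient.nontrivial_iff.2 fun h => hm (top_le_iff.1 (h ▸ hQ))
    exact_mod_cast ringKrullDim_nonneg_of_nontrivial
  | succ n ih =>
    obtain ⟨x, hx, hreg⟩ := exists_isSMulRegular_of_depthGE h
    refine le_trans ?_ (ringKrullDim_sup_span_add_one_le hreg)
    push_cast
    gcongr
    exact ih (sup_le hQ ((Ideal.span_singleton_le_iff_mem _).2 hx))
      (depthGE_sup_span_of_regular hreg h)

lemma depthGE_inf {X Y : Ideal R} {n : ℕ} (hX : DepthGE m (R ⧸ X) n) (hY : DepthGE m (R ⧸ Y) n)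
    (hXY : DepthGE m (R ⧸ (X ⊔ Y)) n) : DepthGE m (R ⧸ (X ⊓ Y)) n := by
  rcases n with - | n
  · exact depthGE_zero
  let f : R ⧸ (X ⊓ Y) →ₗ[R] (R ⧸ X) × (R ⧸ Y) :=
    (Submodule.factor inf_le_left).prod (Submodule.factor inf_le_right)
  let g : (R ⧸ X) × (R ⧸ Y) →ₗ[R] R ⧸ (X ⊔ Y) :=
    (Submodule.factor le_sup_left).coprod (-Submodule.factor le_sup_right)
  refine DepthGE.left (f := f) (g := g) ?_ ?_ ?_ ?_ (hXY.mono n.le_succ)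
  · rw [injective_iff_map_eq_zero]
    intro a ha
    obtain ⟨a, rfl⟩ := Submodule.Quotient.mk_surjective _ a
    have h1 := congrArg Prod.fst ha
    have h2 := congrArg Prod.snd ha
    rw [Submodule.Quotient.mk_eq_zero]
    exact ⟨(Submodule.Quotient.mk_eq_zero X).1 h1, (Submodule.Quotient.mk_eq_zero Y).1 h2⟩
  · intro a
    obtain ⟨a, rfl⟩ := Submodule.Quotient.mk_surjective _ a
    exact ⟨(Submodule.Quotient.mk a, 0), by simp [g]⟩
  · rintro ⟨a, b⟩
    obtain ⟨a, rfl⟩ := Submodule.Quotient.mk_surjective _ a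
    obtain ⟨b, rfl⟩ := Submodule.Quotient.mk_surjective _ b
    have hg : g (Submodule.Quotient.mk a, Submodule.Quotient.mk b) =
        Submodule.Quotient.mk (a - b) := by
      simp [g, sub_eq_add_neg]
    rw [hg, Submodule.Quotient.mk_eq_zero]
    constructor
    · intro hab
      obtain ⟨x, hx, y, hy, hxy⟩ := Submodule.mem_sup.1 hab
      refine ⟨Submodule.Quotient.mk (a - x), Prod.ext ?_ ?_⟩
      · exact (Submodule.Quotient.eq X).2 (by simpa using hx)
      · exact (Submodule.Quotient.eq Y).2 (by
          have : a - x - b = y := by rw [← add_sub_cancel_left x y, hxy]; ring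
          rwa [LinearMap.id_apply, this])
    · rintro ⟨c, hc⟩
      obtain ⟨c, rfl⟩ := Submodule.Quotient.mk_surjective _ c
      have h1 : c - a ∈ X := (Submodule.Quotient.eq X).1 (congrArg Prod.fst hc)
      have h2 : c - b ∈ Y := (Submodule.Quotient.eq Y).1 (congrArg Prod.snd hc)
      have : a - b = (c - b) - (c - a) := by ring
      rw [this]
      exact sub_mem (Ideal.mem_sup_right h2) (Ideal.mem_sup_left h1)
  · exact DepthGE.middle (f := LinearMap.inl R (R ⧸ X) (R ⧸ Y)) (g := LinearMap.snd R _ _)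
      LinearMap.inl_injective LinearMap.snd_surjective Function.Exact.inl_snd hX hY

end Cyclic

section Powers

lemma sup_pow_le_pow_sup_pow (I J : Ideal R) {a b i : ℕ} (h : a + b ≤ i + 1) :
    (I ⊔ J) ^ i ≤ I ^ a ⊔ J ^ b := by
  rw [← Submodule.add_eq_sup, add_pow, Ideal.sum_eq_sup]
  refine Finset.sup_le fun j hj => Ideal.mul_le_left.trans ?_
  have hj' := Finset.mem_range.1 hj
  rcases le_or_gt a j with h' | h'
  · exact le_sup_of_le_left (Ideal.mul_le_left.trans (Ideal.pow_le_pow_right h'))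
  · exact le_sup_of_le_right
      (Ideal.mul_le_right.trans (Ideal.pow_le_pow_right (show b ≤ i - j by lia)))

variable {m I J : Ideal R}

lemma mul_pow_le_sup_pow (I J : Ideal R) (a b : ℕ) : I ^ a * J ^ b ≤ (I ⊔ J) ^ (a + b) := by
  rw [pow_add]
  exact Ideal.mul_mono (Ideal.pow_right_mono le_sup_left a) (Ideal.pow_right_mono le_sup_right b)

/-- Depth of `R ⧸ (I ⊔ J) ^ i` is bounded below by those of the `R ⧸ (I ^ a ⊔ J ^ b)`. -/
lemma depthGE_sup_pow (hIJ : ∀ a b, I ^ a ⊓ J ^ b ≤ I ^ a * J ^ b) {n d : ℕ}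
    (h : ∀ a b, 1 ≤ a → a ≤ n → 1 ≤ b → b ≤ n → DepthGE m (R ⧸ (I ^ a ⊔ J ^ b)) d) {i : ℕ}
    (hi : 1 ≤ i) (hin : i ≤ n) : DepthGE m (R ⧸ (I ⊔ J) ^ i) d := by
  have key : ∀ a, 1 ≤ a → a ≤ i → DepthGE m (R ⧸ (I ^ a ⊔ (I ⊔ J) ^ i)) d := by
    intro a ha
    induction a, ha using Nat.le_induction with
    | base =>
      intro _
      have : I ^ 1 ⊔ (I ⊔ J) ^ i = I ^ 1 ⊔ J ^ i :=
        le_antisymm (sup_le le_sup_left (sup_pow_le_pow_sup_pow I J (by lia)))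
          (sup_le_sup_left (Ideal.pow_right_mono le_sup_right i) _)
      rw [this]
      exact h 1 i le_rfl (hi.trans hin) hi hin
    | succ a ha ih =>
      intro hai
      have hQ : (I ⊔ J) ^ i ≤ I ^ (a + 1) ⊔ J ^ (i - a) := sup_pow_le_pow_sup_pow I J (by lia)
      have hpow : I ^ (a + 1) ≤ I ^ a := Ideal.pow_le_pow_right a.le_succ
      have h1 : I ^ (a + 1) ⊔ (I ⊔ J) ^ i =
          (I ^ a ⊔ (I ⊔ J) ^ i) ⊓ (I ^ (a + 1) ⊔ J ^ (i - a)) := by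
        refine le_antisymm (le_inf (sup_le_sup_right hpow _) (sup_le le_sup_left hQ)) ?_
        rw [sup_comm (I ^ a), sup_inf_assoc_of_le _ hQ, inf_comm, sup_inf_assoc_of_le _ hpow]
        refine sup_le le_sup_right (sup_le le_sup_left ?_)
        rw [inf_comm]
        refine (hIJ _ _).trans ((mul_pow_le_sup_pow I J _ _).trans ?_)
        rw [Nat.add_sub_cancel' (by lia)]
        exact le_sup_right
      have h2 : (I ^ a ⊔ (I ⊔ J) ^ i) ⊔ (I ^ (a + 1) ⊔ J ^ (i - a)) = I ^ a ⊔ J ^ (i - a) :=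
        le_antisymm (sup_le (sup_le le_sup_left (hQ.trans (sup_le_sup_right hpow _)))
          (sup_le_sup_right hpow _))
          (sup_le_sup le_sup_left le_sup_right)
      rw [h1]
      refine depthGE_inf (ih (by lia)) (h _ _ (by lia) (by lia) (by lia) (by lia)) ?_
      rw [h2]
      exact h _ _ ha (by lia) (by lia) (by lia)
  have := key i hi le_rfl
  rwa [sup_eq_right.2 (Ideal.pow_right_mono le_sup_left i)] at this

lemma exists_comp_eq_of_ker_le {M N P : Type} [AddCommGroup M] [Module R M] [AddCommGroup N]
    [Module R N] [AddCommGroup P] [Module R P] (α : M →ₗ[R] N) (β : M →ₗ[R] P)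
    (hα : Function.Surjective α) (h : LinearMap.ker α ≤ LinearMap.ker β) :
    ∃ i : N →ₗ[R] P, i ∘ₗ α = β := by
  refine ⟨(LinearMap.ker α).liftQ β h ∘ₗ (α.quotKerEquivOfSurjective hα).symm.toLinearMap, ?_⟩
  ext x
  have : (α.quotKerEquivOfSurjective hα).symm (α x) = Submodule.Quotient.mk x := by
    rw [LinearEquiv.symm_apply_eq]
    rfl
  simp [this]

/-- Depth of `R ⧸ (I ^ a ⊔ J)` is bounded below by those of the `R ⧸ (I ⊔ J) ^ i`. -/
lemma depthGE_pow_sup (hIJ : ∀ a b, I ^ a ⊓ J ^ b ≤ I ^ a * J ^ b) {n d : ℕ}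
    (h : ∀ i, 1 ≤ i → i ≤ n → DepthGE m (R ⧸ (I ⊔ J) ^ i) d) {a : ℕ}
    (ha : 1 ≤ a) (han : a ≤ n) : DepthGE m (R ⧸ (I ^ a ⊔ J)) d := by
  rcases d with - | d
  · exact depthGE_zero
  induction a, ha using Nat.le_induction with
  | base =>
    have := h 1 le_rfl han
    rwa [pow_one] at this ⊢
  | succ a ha ih =>
    have h1 : (I ⊔ J) ^ (a + 1) ≤ (I ⊔ J) ^ a := Ideal.pow_le_pow_right a.le_succ
    have h2 : I ^ (a + 1) ⊔ J ≤ I ^ a ⊔ J := sup_le_sup_right (Ideal.pow_le_pow_right a.le_succ) _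
    have h3 : (I ⊔ J) ^ (a + 1) ≤ I ^ (a + 1) ⊔ J := by
      simpa using sup_pow_le_pow_sup_pow I J (a := a + 1) (b := 1) (i := a + 1) le_rfl
    have h4 : (I ⊔ J) ^ a ≤ I ^ a ⊔ J := by
      simpa using sup_pow_le_pow_sup_pow I J (a := a) (b := 1) (i := a) le_rfl
    have hIQ : I ^ a ≤ (I ⊔ J) ^ a := Ideal.pow_right_mono le_sup_left a
    have hK : DepthGE m (LinearMap.ker (Submodule.factor h1)) (d + 1) :=
      DepthGE.left (Submodule.subtype_injective _) (Submodule.factor_surjective h1)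
        (LinearMap.exact_subtype_ker_map _) (h (a + 1) (by lia) han)
        ((h a ha (by lia)).mono d.le_succ)
    let p : LinearMap.ker (Submodule.factor h1) →ₗ[R] LinearMap.ker (Submodule.factor h2) :=
      (Submodule.factor h3).restrict (by
        intro x hx
        obtain ⟨x, rfl⟩ := Submodule.Quotient.mk_surjective _ x
        exact (Submodule.Quotient.mk_eq_zero _).2 (h4 ((Submodule.Quotient.mk_eq_zero _).1 hx)))
    let β : (I ^ a : Ideal R) →ₗ[R] LinearMap.ker (Submodule.factor h1) :=
      (Submodule.mkQ _ ∘ₗ (I ^ a).subtype).codRestrict _ (fun x =>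
        (Submodule.Quotient.mk_eq_zero _).2 (hIQ x.2))
    have hα : Function.Surjective (p ∘ₗ β) := by
      rintro ⟨x, hx⟩
      obtain ⟨x, rfl⟩ := Submodule.Quotient.mk_surjective _ x
      obtain ⟨y, hy, z, hz, rfl⟩ := Submodule.mem_sup.1 ((Submodule.Quotient.mk_eq_zero _).1 hx)
      refine ⟨⟨y, hy⟩, Subtype.ext ((Submodule.Quotient.eq _).2 ?_)⟩
      have : y - (y + z) = -z := by ring
      rw [LinearMap.id_apply]
      exact this ▸ Ideal.mem_sup_right (neg_mem hz)
    obtain ⟨i, hi⟩ := exists_comp_eq_of_ker_le (p ∘ₗ β) β hα (by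
      rintro ⟨x, hx⟩ hx0
      have hx1 : x ∈ I ^ (a + 1) ⊔ J :=
        (Submodule.Quotient.mk_eq_zero _).1 (congrArg Subtype.val hx0)
      obtain ⟨y, hy, z, hz, rfl⟩ := Submodule.mem_sup.1 hx1
      refine Subtype.ext ((Submodule.Quotient.mk_eq_zero _).2 ?_)
      refine add_mem (Ideal.pow_right_mono le_sup_left _ hy) (mul_pow_le_sup_pow I J a 1
        (hIJ a 1 ⟨?_, by simpa using hz⟩))
      simpa using sub_mem hx (Ideal.pow_le_pow_right a.le_succ hy))
    have hK' : DepthGE m (LinearMap.ker (Submodule.factor h2)) (d + 1) :=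
      hK.of_retract i p (by
        rw [← LinearMap.cancel_right hα, LinearMap.comp_assoc, hi, LinearMap.id_comp])
    exact DepthGE.middle (Submodule.subtype_injective _) (Submodule.factor_surjective h2)
      (LinearMap.exact_subtype_ker_map _) hK' (ih (by lia))

end Powers

section KrullDimension

lemma ringKrullDim_eq_of_isIntegral_of_injective {S T : Type*} [CommRing S] [CommRing T]
    (f : S →+* T) (hint : f.IsIntegral) (hinj : Function.Injective f) :
    ringKrullDim S = ringKrullDim T := by
  algebraize [f]
  have : Algebra.IsIntegral S T := ⟨hint⟩
  refine le_antisymm ?_ (Order.krullDim_le_of_strictMono (PrimeSpectrum.comap f)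
    fun p q hpq => Ideal.IsIntegral.comap_lt_comap (R := S) hpq)
  refine iSup_le fun l => ?_
  obtain ⟨Q, -, hQ, hQl⟩ := Ideal.exists_ideal_over_prime_of_isIntegral (S := T)
    l.head.asIdeal ⊥ (by
      rw [← RingHom.ker_eq_comap_bot, (RingHom.injective_iff_ker_eq_bot (algebraMap S T)).1 hinj]
      exact bot_le)
  have : Q.LiesOver l.head.asIdeal := ⟨hQl.symm⟩
  obtain ⟨L, hL, -⟩ := Ideal.exists_ltSeries_of_hasGoingUp l Q
  exact hL ▸ le_iSup (fun p : LTSeries (PrimeSpectrum T) => (p.length : WithBot ℕ∞)) L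

lemma ringKrullDim_quotient_eq_of_surjective {S T : Type*} [CommRing S] [CommRing T]
    {f : S →+* T} (hf : Function.Surjective f) {K : Ideal S} (hK : ∀ x, f x = 0 ↔ x ∈ K) :
    ringKrullDim (S ⧸ K) = ringKrullDim T := by
  obtain rfl : RingHom.ker f = K := Ideal.ext hK
  exact ringKrullDim_eq_of_ringEquiv (RingHom.quotientKerEquivOfSurjective hf)

open TensorProduct in
lemma ringKrullDim_tensorProduct (k S T : Type*) [Field k] [CommRing S] [CommRing T]
    [Nontrivial S] [Nontrivial T] [Algebra k S] [Algebra k T] [Algebra.FiniteType k S]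
    [Algebra.FiniteType k T] :
    ringKrullDim (S ⊗[k] T) = ringKrullDim S + ringKrullDim T := by
  obtain ⟨a, f, hf, hf'⟩ := exists_finite_inj_algHom_of_fg k S
  obtain ⟨b, g, hg, hg'⟩ := exists_finite_inj_algHom_of_fg k T
  have hinj : Function.Injective (Algebra.TensorProduct.map f g) :=
    TensorProduct.map_injective_of_flat_flat f.toLinearMap g.toLinearMap hf hg
  rw [← ringKrullDim_eq_of_isIntegral_of_injective f.toRingHom hf'.to_isIntegral hf,
    ← ringKrullDim_eq_of_isIntegral_of_injective g.toRingHom hg'.to_isIntegral hg,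
    ← ringKrullDim_eq_of_isIntegral_of_injective (Algebra.TensorProduct.map f g).toRingHom
      (RingHom.Finite.tensorProductMap hf' hg').to_isIntegral hinj,
    ringKrullDim_eq_of_ringEquiv
      (MvPolynomial.tensorEquivSum k (Fin a) (Fin b) k).toRingEquiv]
  simp

end KrullDimension

section Tensor

open TensorProduct

variable {k : Type} [Field k]

lemma tmul_ne_zero {M N : Type} [AddCommGroup M] [Module k M] [AddCommGroup N] [Module k N]
    {u : M} {v : N} (hu : u ≠ 0) (hv : v ≠ 0) : u ⊗ₜ[k] v ≠ 0 := by
  have hinj := Module.Flat.rTensor_preserves_injective_linearMap (M := N)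
    (LinearMap.toSpanSingleton k M u) (LinearMap.ker_eq_bot.1 (LinearMap.ker_toSpanSingleton k hu))
  intro h
  have : (1 : k) ⊗ₜ[k] v = 0 := hinj (by simpa using h)
  exact hv (by simpa using congrArg (TensorProduct.lid k N) this)

lemma eq_zero_of_tmul_one_mul_eq_zero {S T : Type} [CommRing S] [CommRing T] [Algebra k S]
    [Algebra k T] {s : S} (hs : IsLeftRegular s) {z : S ⊗[k] T} (h : s ⊗ₜ[k] (1 : T) * z = 0) :
    z = 0 := by
  refine Module.Flat.rTensor_preserves_injective_linearMap (M := T) (LinearMap.mulLeft k s) hs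
    (Eq.trans ?_ (h.trans (map_zero _).symm))
  clear h
  induction z with
  | zero => simp
  | tmul p q => simp
  | add p q hp hq => rw [map_add, hp, hq, mul_add]

lemma eq_zero_of_one_tmul_mul_eq_zero {S T : Type} [CommRing S] [CommRing T] [Algebra k S]
    [Algebra k T] {t : T} (ht : IsLeftRegular t) {z : S ⊗[k] T} (h : (1 : S) ⊗ₜ[k] t * z = 0) :
    z = 0 := by
  refine Module.Flat.lTensor_preserves_injective_linearMap (M := S) (LinearMap.mulLeft k t) ht
    (Eq.trans ?_ (h.trans (map_zero _).symm))
  clear h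
  induction z with
  | zero => simp
  | tmul p q => simp
  | add p q hp hq => rw [map_add, hp, hq, mul_add]

variable {σ τ : Type}

lemma tensorEquivSum_tmul (a : MvPolynomial σ k) (b : MvPolynomial τ k) :
    MvPolynomial.tensorEquivSum k σ τ k (a ⊗ₜ b) =
      MvPolynomial.rename Sum.inl a * MvPolynomial.rename Sum.inr b := by
  have h1 : ((MvPolynomial.tensorEquivSum k σ τ k).toAlgHom.comp
      Algebra.TensorProduct.includeLeft : MvPolynomial σ k →ₐ[k] MvPolynomial (σ ⊕ τ) k) =
      MvPolynomial.rename Sum.inl := by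
    ext i; simp
  have h2 : ((MvPolynomial.tensorEquivSum k σ τ k).toAlgHom.comp
      Algebra.TensorProduct.includeRight : MvPolynomial τ k →ₐ[k] MvPolynomial (σ ⊕ τ) k) =
      MvPolynomial.rename Sum.inr := by
    ext i; simp
  rw [← h1, ← h2]
  simp [← map_mul]

lemma tensorEquivSum_symm_rename_inl (a : MvPolynomial σ k) :
    (MvPolynomial.tensorEquivSum k σ τ k).symm (MvPolynomial.rename Sum.inl a) = a ⊗ₜ 1 := by
  rw [AlgEquiv.symm_apply_eq, tensorEquivSum_tmul, map_one, mul_one]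

lemma tensorEquivSum_symm_rename_inr (b : MvPolynomial τ k) :
    (MvPolynomial.tensorEquivSum k σ τ k).symm (MvPolynomial.rename Sum.inr b) = 1 ⊗ₜ b := by
  rw [AlgEquiv.symm_apply_eq, tensorEquivSum_tmul, map_one, one_mul]

variable (τ) in
lemma map_rename_inl_le_comap (I : Ideal (MvPolynomial σ k)) :
    I.map (MvPolynomial.rename (Sum.inl : σ → σ ⊕ τ)) ≤
      (I.map (Algebra.TensorProduct.includeLeft :
        MvPolynomial σ k →ₐ[k] MvPolynomial σ k ⊗[k] MvPolynomial τ k)).comap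
        (MvPolynomial.tensorEquivSum k σ τ k).symm :=
  Ideal.map_le_iff_le_comap.2 fun a ha => by
    rw [Ideal.mem_comap, Ideal.mem_comap, tensorEquivSum_symm_rename_inl]
    exact Ideal.mem_map_of_mem Algebra.TensorProduct.includeLeft ha

variable (σ) in
lemma map_rename_inr_le_comap (J : Ideal (MvPolynomial τ k)) :
    J.map (MvPolynomial.rename (Sum.inr : τ → σ ⊕ τ)) ≤
      (J.map (Algebra.TensorProduct.includeRight :
        MvPolynomial τ k →ₐ[k] MvPolynomial σ k ⊗[k] MvPolynomial τ k)).comap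
        (MvPolynomial.tensorEquivSum k σ τ k).symm :=
  Ideal.map_le_iff_le_comap.2 fun b hb => by
    rw [Ideal.mem_comap, Ideal.mem_comap, tensorEquivSum_symm_rename_inr]
    exact Ideal.mem_map_of_mem Algebra.TensorProduct.includeRight hb

/-- The ideal of `k[x, y]` generated by an ideal of `k[x]` and an ideal of `k[y]`. -/
noncomputable abbrev extendedSup (I : Ideal (MvPolynomial σ k)) (J : Ideal (MvPolynomial τ k)) :
    Ideal (MvPolynomial (σ ⊕ τ) k) :=
  I.map (MvPolynomial.rename Sum.inl) ⊔ J.map (MvPolynomial.rename Sum.inr)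

/-- The quotient of `k[x, y]` by the ideals extended from `k[x]` and `k[y]` is a tensor product. -/
lemma exists_surjective_tensorProduct (I : Ideal (MvPolynomial σ k))
    (J : Ideal (MvPolynomial τ k)) :
    ∃ φ : MvPolynomial (σ ⊕ τ) k →+* (MvPolynomial σ k ⧸ I) ⊗[k] (MvPolynomial τ k ⧸ J),
      Function.Surjective φ ∧
      (∀ f, φ f = 0 ↔ f ∈ extendedSup I J) ∧
      (∀ a, φ (MvPolynomial.rename Sum.inl a) = Ideal.Quotient.mk I a ⊗ₜ 1) ∧
      ∀ b, φ (MvPolynomial.rename Sum.inr b) = 1 ⊗ₜ Ideal.Quotient.mk J b := by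
  let e := MvPolynomial.tensorEquivSum k σ τ k
  let π := Algebra.TensorProduct.map (Ideal.Quotient.mkₐ k I) (Ideal.Quotient.mkₐ k J)
  have hker : RingHom.ker π = I.map (Algebra.TensorProduct.includeLeft :
      MvPolynomial σ k →ₐ[k] MvPolynomial σ k ⊗[k] MvPolynomial τ k) ⊔
      J.map (Algebra.TensorProduct.includeRight :
      MvPolynomial τ k →ₐ[k] MvPolynomial σ k ⊗[k] MvPolynomial τ k) := by
    have := Algebra.TensorProduct.map_ker (Ideal.Quotient.mkₐ k I) (Ideal.Quotient.mkₐ k J)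
      (Ideal.Quotient.mkₐ_surjective k I) (Ideal.Quotient.mkₐ_surjective k J)
    have hI : RingHom.ker (Ideal.Quotient.mkₐ k I) = I := Ideal.Quotient.mkₐ_ker k I
    have hJ : RingHom.ker (Ideal.Quotient.mkₐ k J) = J := Ideal.Quotient.mkₐ_ker k J
    rwa [hI, hJ] at this
  refine ⟨(π.comp e.symm.toAlgHom).toRingHom, ?_, fun f => ?_, fun a => ?_, fun b => ?_⟩
  · exact (Algebra.TensorProduct.map_surjective _ _ (Ideal.Quotient.mkₐ_surjective k I)
      (Ideal.Quotient.mkₐ_surjective k J)).comp e.symm.surjective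
  · change e.symm f ∈ RingHom.ker π ↔ _
    constructor
    · intro hf
      rw [hker] at hf
      have hle : I.map (Algebra.TensorProduct.includeLeft :
          MvPolynomial σ k →ₐ[k] MvPolynomial σ k ⊗[k] MvPolynomial τ k) ⊔
          J.map (Algebra.TensorProduct.includeRight :
          MvPolynomial τ k →ₐ[k] MvPolynomial σ k ⊗[k] MvPolynomial τ k) ≤
          (extendedSup I J).comap e := by
        refine sup_le (Ideal.map_le_iff_le_comap.2 fun a ha => ?_)
          (Ideal.map_le_iff_le_comap.2 fun b hb => ?_)
        · rw [Ideal.mem_comap, Ideal.mem_comap, Algebra.TensorProduct.includeLeft_apply,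
            ← tensorEquivSum_symm_rename_inl, e.apply_symm_apply]
          exact Ideal.mem_sup_left (Ideal.mem_map_of_mem _ ha)
        · rw [Ideal.mem_comap, Ideal.mem_comap, Algebra.TensorProduct.includeRight_apply,
            ← tensorEquivSum_symm_rename_inr, e.apply_symm_apply]
          exact Ideal.mem_sup_right (Ideal.mem_map_of_mem _ hb)
      simpa using hle hf
    · intro hf
      have hle : extendedSup I J ≤ (RingHom.ker π).comap e.symm := by
        rw [hker]
        exact sup_le ((map_rename_inl_le_comap τ I).trans (Ideal.comap_mono le_sup_left))
          ((map_rename_inr_le_comap σ J).trans (Ideal.comap_mono le_sup_right))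
      exact hle hf
  · change π (e.symm _) = _
    rw [tensorEquivSum_symm_rename_inl]
    rfl
  · change π (e.symm _) = _
    rw [tensorEquivSum_symm_rename_inr]
    rfl

variable {I : Ideal (MvPolynomial σ k)} {J : Ideal (MvPolynomial τ k)}

lemma rename_mul_rename_notMem {u : MvPolynomial σ k} {v : MvPolynomial τ k} (hu : u ∉ I)
    (hv : v ∉ J) :
    MvPolynomial.rename Sum.inl u * MvPolynomial.rename Sum.inr v ∉ extendedSup I J := by
  obtain ⟨φ, -, hker, hl, hr⟩ := exists_surjective_tensorProduct I J
  rw [← hker, map_mul, hl, hr, Algebra.TensorProduct.tmul_mul_tmul, one_mul, mul_one]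
  exact tmul_ne_zero (mt Ideal.Quotient.eq_zero_iff_mem.1 hu)
    (mt Ideal.Quotient.eq_zero_iff_mem.1 hv)

lemma isSMulRegular_rename_inl {x : MvPolynomial σ k}
    (hx : IsSMulRegular (MvPolynomial σ k ⧸ I) x) :
    IsSMulRegular (MvPolynomial (σ ⊕ τ) k ⧸ extendedSup I J)
      (MvPolynomial.rename (Sum.inl : σ → σ ⊕ τ) x) := by
  obtain ⟨φ, -, hker, hl, -⟩ := exists_surjective_tensorProduct I J
  refine isSMulRegular_quotient_iff.2 fun a ha => ?_
  rw [← hker, map_mul, hl] at ha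
  exact (hker a).1 (eq_zero_of_tmul_one_mul_eq_zero (fun _ _ h => hx h) ha)

lemma isSMulRegular_rename_inr {x : MvPolynomial τ k}
    (hx : IsSMulRegular (MvPolynomial τ k ⧸ J) x) :
    IsSMulRegular (MvPolynomial (σ ⊕ τ) k ⧸ extendedSup I J)
      (MvPolynomial.rename (Sum.inr : τ → σ ⊕ τ) x) := by
  obtain ⟨φ, -, hker, -, hr⟩ := exists_surjective_tensorProduct I J
  refine isSMulRegular_quotient_iff.2 fun a ha => ?_
  rw [← hker, map_mul, hr] at ha
  exact (hker a).1 (eq_zero_of_one_tmul_mul_eq_zero (fun _ _ h => hx h) ha)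

lemma ringKrullDim_quotient_extendedSup [Finite σ] [Finite τ] (hI : I ≠ ⊤) (hJ : J ≠ ⊤) :
    ringKrullDim (MvPolynomial (σ ⊕ τ) k ⧸ extendedSup I J) =
      ringKrullDim (MvPolynomial σ k ⧸ I) + ringKrullDim (MvPolynomial τ k ⧸ J) := by
  have := Ideal.Quotient.nontrivial_iff.2 hI
  have := Ideal.Quotient.nontrivial_iff.2 hJ
  obtain ⟨φ, hφ, hker, -, -⟩ := exists_surjective_tensorProduct I J
  rw [← ringKrullDim_tensorProduct k]
  exact ringKrullDim_quotient_eq_of_surjective hφ hker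

variable (I J) in
lemma map_rename_inl_inf_map_rename_inr_le :
    I.map (MvPolynomial.rename (Sum.inl : σ → σ ⊕ τ)) ⊓
        J.map (MvPolynomial.rename (Sum.inr : τ → σ ⊕ τ)) ≤
      I.map (MvPolynomial.rename (Sum.inl : σ → σ ⊕ τ)) *
        J.map (MvPolynomial.rename (Sum.inr : τ → σ ⊕ τ)) := by
  rintro f ⟨hfI, hfJ⟩
  let e := MvPolynomial.tensorEquivSum k σ τ k
  let I' := I.restrictScalars k
  let J' := J.restrictScalars k
  have hI : e.symm f ∈ LinearMap.range (LinearMap.rTensor (MvPolynomial τ k) I'.subtype) := by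
    rw [← Ideal.map_includeLeft_eq]
    exact map_rename_inl_le_comap τ I hfI
  have hJ : e.symm f ∈ LinearMap.range (LinearMap.lTensor (MvPolynomial σ k) J'.subtype) := by
    rw [← Ideal.map_includeRight_eq]
    exact map_rename_inr_le_comap σ J hfJ
  obtain ⟨z, hz⟩ := hI
  have hinj := Module.Flat.rTensor_preserves_injective_linearMap (M := MvPolynomial τ k ⧸ J')
    I'.subtype I'.subtype_injective
  have hJ0 : LinearMap.lTensor (MvPolynomial σ k) J'.mkQ (e.symm f) = 0 :=
    (lTensor_exact (MvPolynomial σ k) (LinearMap.exact_subtype_mkQ J')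
      J'.mkQ_surjective (e.symm f)).2 hJ
  have hz0 : LinearMap.lTensor I' J'.mkQ z = 0 := hinj (by
    rw [map_zero, ← LinearMap.comp_apply, LinearMap.rTensor_comp_lTensor,
      ← LinearMap.lTensor_comp_rTensor, LinearMap.comp_apply, hz, hJ0])
  obtain ⟨w, rfl⟩ := (lTensor_exact I' (LinearMap.exact_subtype_mkQ J')
      J'.mkQ_surjective z).1 hz0
  have key : ∀ w : I' ⊗[k] J', e (LinearMap.rTensor (MvPolynomial τ k) I'.subtype
      (LinearMap.lTensor I' J'.subtype w)) ∈
      I.map (MvPolynomial.rename (Sum.inl : σ → σ ⊕ τ)) *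
        J.map (MvPolynomial.rename (Sum.inr : τ → σ ⊕ τ)) := by
    intro w
    induction w with
    | zero => simp
    | tmul p q =>
      rw [LinearMap.lTensor_tmul, LinearMap.rTensor_tmul, tensorEquivSum_tmul]
      exact Ideal.mul_mem_mul (Ideal.mem_map_of_mem _ p.2) (Ideal.mem_map_of_mem _ q.2)
    | add p q hp hq => simpa only [map_add] using add_mem hp hq
  have := key w
  rwa [hz, e.apply_symm_apply] at this

end Tensor

section CohenMacaulay

open PaperHTT

/-- The depth of `M` with respect to `m`, measured by the vanishing of `Ext`, equals `n`. -/
def HasDepth (m : Ideal R) (M : Type) [AddCommGroup M] [Module R M] (n : ℕ) : Prop :=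
  DepthGE m M n ∧ ¬ DepthGE m M (n + 1)

lemma HasDepth.le_of_depthGE {m : Ideal R} {M : Type} [AddCommGroup M] [Module R M] {n d : ℕ}
    (h : HasDepth m M n) (hd : DepthGE m M d) : d ≤ n := by
  by_contra! hlt
  exact h.2 (hd.mono hlt)

lemma hasDepth_succ_iff_of_regular {m Q : Ideal R} {x : R} {n : ℕ} (hx : x ∈ m)
    (hreg : IsSMulRegular (R ⧸ Q) x) :
    HasDepth m (R ⧸ Q) (n + 1) ↔ HasDepth m (R ⧸ (Q ⊔ Ideal.span {x})) n := by
  rw [HasDepth, HasDepth, depthGE_succ_iff_of_regular hx hreg,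
    depthGE_succ_iff_of_regular hx hreg]

lemma sInf_nontrivial_localCohomology_quotient [IsNoetherianRing R] {m Q : Ideal R} (hm : m ≠ ⊤)
    (hQ : Q ≤ m) {p : ℕ} (h : HasDepth m (R ⧸ Q) p) :
    sInf {i : ℕ | Nontrivial ((localCohomology m i).obj (ModuleCat.of R (R ⧸ Q)))} = p :=
  sInf_nontrivial_localCohomology m (smul_top_quotient_lt_top hm hQ) h.1 h.2

variable {k : Type} [Field k] {σ τ : Type}

lemma mem_maxHomIdeal_iff {f : MvPolynomial σ k} :
    f ∈ maxHomIdeal k σ ↔ MvPolynomial.constantCoeff f = 0 := by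
  have := MvPolynomial.mem_pow_idealOfVars_iff' (σ := σ) (R := k) 1 f
  rw [pow_one] at this
  exact this.trans ⟨fun h => h 0 (by simp), fun h x hx => by
    rw [Nat.lt_one_iff, Finsupp.degree_eq_zero_iff] at hx
    rwa [hx]⟩

lemma maxHomIdeal_ne_top : maxHomIdeal k σ ≠ ⊤ := fun h => by
  have : (1 : MvPolynomial σ k) ∈ maxHomIdeal k σ := h ▸ Submodule.mem_top
  rw [mem_maxHomIdeal_iff, map_one] at this
  exact one_ne_zero this

lemma le_maxHomIdeal_of_isHomogeneousIdeal {I : Ideal (MvPolynomial σ k)}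
    (hI : IsHomogeneousIdeal k I) (hI1 : I ≠ ⊤) : I ≤ maxHomIdeal k σ := by
  intro f hf
  rw [mem_maxHomIdeal_iff]
  by_contra hne
  have := hI f hf 0
  rw [MvPolynomial.homogeneousComponent_zero] at this
  exact hI1 (Ideal.eq_top_of_isUnit_mem _ this ((Ne.isUnit hne).map MvPolynomial.C))

lemma extendedSup_maxHomIdeal :
    extendedSup (maxHomIdeal k σ) (maxHomIdeal k τ) = maxHomIdeal k (σ ⊕ τ) := by
  rw [extendedSup, maxHomIdeal, maxHomIdeal, maxHomIdeal, Ideal.map_span, Ideal.map_span,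
    ← Ideal.span_union, ← Set.range_comp, ← Set.range_comp]
  congr 1
  ext f
  simp [Set.mem_range]

lemma extendedSup_mono {I I' : Ideal (MvPolynomial σ k)} {J J' : Ideal (MvPolynomial τ k)}
    (hI : I ≤ I') (hJ : J ≤ J') : extendedSup I J ≤ extendedSup I' J' :=
  sup_le_sup (Ideal.map_mono hI) (Ideal.map_mono hJ)

lemma hasDepth_zero_extendedSup [Finite σ] [Finite τ] {I : Ideal (MvPolynomial σ k)}
    {J : Ideal (MvPolynomial τ k)} (hI : I ≤ maxHomIdeal k σ) (hJ : J ≤ maxHomIdeal k τ)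
    (h : HasDepth (maxHomIdeal k σ) (MvPolynomial σ k ⧸ I) 0)
    (h' : HasDepth (maxHomIdeal k τ) (MvPolynomial τ k ⧸ J) 0) :
    HasDepth (maxHomIdeal k (σ ⊕ τ)) (MvPolynomial (σ ⊕ τ) k ⧸ extendedSup I J) 0 := by
  refine ⟨depthGE_zero, ?_⟩
  obtain ⟨u, hu, hu'⟩ := (not_depthGE_one_iff maxHomIdeal_ne_top hI).1 h.2
  obtain ⟨v, hv, hv'⟩ := (not_depthGE_one_iff maxHomIdeal_ne_top hJ).1 h'.2
  have hIJ := extendedSup_mono hI hJ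
  rw [extendedSup_maxHomIdeal] at hIJ
  refine (not_depthGE_one_iff maxHomIdeal_ne_top hIJ).2
    ⟨_, rename_mul_rename_notMem hu hv, fun x hx => ?_⟩
  rw [maxHomIdeal] at hx
  induction hx using Submodule.span_induction with
  | zero => simp
  | add x y _ _ hx hy => simpa only [add_mul] using add_mem hx hy
  | smul a x _ hx => simpa only [smul_eq_mul, mul_assoc] using Ideal.mul_mem_left _ a hx
  | mem x hx =>
    obtain ⟨i | i, rfl⟩ := hx
    · have := Ideal.mem_map_of_mem (MvPolynomial.rename (Sum.inl : σ → σ ⊕ τ))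
        (hu' (MvPolynomial.X i) (Ideal.subset_span ⟨i, rfl⟩))
      rw [map_mul, MvPolynomial.rename_X] at this
      rw [← mul_assoc]
      exact Ideal.mul_mem_right _ _ (Ideal.mem_sup_left this)
    · have := Ideal.mem_map_of_mem (MvPolynomial.rename (Sum.inr : τ → σ ⊕ τ))
        (hv' (MvPolynomial.X i) (Ideal.subset_span ⟨i, rfl⟩))
      rw [map_mul, MvPolynomial.rename_X] at this
      rw [mul_left_comm]
      exact Ideal.mul_mem_left _ _ (Ideal.mem_sup_right this)

lemma rename_inl_mem_maxHomIdeal {x : MvPolynomial σ k} (hx : x ∈ maxHomIdeal k σ) :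
    MvPolynomial.rename Sum.inl x ∈ maxHomIdeal k (σ ⊕ τ) :=
  extendedSup_maxHomIdeal (k := k) (σ := σ) (τ := τ) ▸
    Ideal.mem_sup_left (Ideal.mem_map_of_mem _ hx)

lemma rename_inr_mem_maxHomIdeal {x : MvPolynomial τ k} (hx : x ∈ maxHomIdeal k τ) :
    MvPolynomial.rename Sum.inr x ∈ maxHomIdeal k (σ ⊕ τ) :=
  extendedSup_maxHomIdeal (k := k) (σ := σ) (τ := τ) ▸
    Ideal.mem_sup_right (Ideal.mem_map_of_mem _ hx)

/-- Depth is additive on tensor products over a field. -/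
lemma hasDepth_extendedSup [Finite σ] [Finite τ] {p q : ℕ} {I : Ideal (MvPolynomial σ k)}
    {J : Ideal (MvPolynomial τ k)} (hI : I ≤ maxHomIdeal k σ) (hJ : J ≤ maxHomIdeal k τ)
    (h : HasDepth (maxHomIdeal k σ) (MvPolynomial σ k ⧸ I) p)
    (h' : HasDepth (maxHomIdeal k τ) (MvPolynomial τ k ⧸ J) q) :
    HasDepth (maxHomIdeal k (σ ⊕ τ)) (MvPolynomial (σ ⊕ τ) k ⧸ extendedSup I J) (p + q) := by
  induction p generalizing I with
  | succ p ih =>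
    obtain ⟨x, hx, hreg⟩ := exists_isSMulRegular_of_depthGE h.1
    rw [add_right_comm, hasDepth_succ_iff_of_regular (rename_inl_mem_maxHomIdeal hx)
      (isSMulRegular_rename_inl hreg)]
    have := ih (sup_le hI ((Ideal.span_singleton_le_iff_mem _).2 hx))
      ((hasDepth_succ_iff_of_regular hx hreg).1 h)
    rwa [extendedSup, Ideal.map_sup, Ideal.map_span, Set.image_singleton, sup_right_comm] at this
  | zero =>
    induction q generalizing J with
    | zero => exact hasDepth_zero_extendedSup hI hJ h h'
    | succ q ih =>
      obtain ⟨x, hx, hreg⟩ := exists_isSMulRegular_of_depthGE h'.1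
      rw [← add_assoc, hasDepth_succ_iff_of_regular (rename_inr_mem_maxHomIdeal hx)
        (isSMulRegular_rename_inr hreg)]
      have := ih (sup_le hJ ((Ideal.span_singleton_le_iff_mem _).2 hx))
        ((hasDepth_succ_iff_of_regular hx hreg).1 h')
      rwa [extendedSup, Ideal.map_sup, Ideal.map_span, Set.image_singleton, ← sup_assoc] at this

lemma exists_ringKrullDim_quotient_eq [Finite σ] {Q : Ideal (MvPolynomial σ k)} (hQ : Q ≠ ⊤) :
    ∃ d : ℕ, ringKrullDim (MvPolynomial σ k ⧸ Q) = d := by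
  have := Ideal.Quotient.nontrivial_iff.2 hQ
  obtain ⟨s, g, hg, hfin⟩ := exists_finite_inj_algHom_of_fg k (MvPolynomial σ k ⧸ Q)
  refine ⟨s, ?_⟩
  rw [← ringKrullDim_eq_of_isIntegral_of_injective g.toRingHom hfin.to_isIntegral hg]
  simp

lemma exists_hasDepth [Finite σ] {Q : Ideal (MvPolynomial σ k)} (hQ : Q ≤ maxHomIdeal k σ) :
    ∃ p, HasDepth (maxHomIdeal k σ) (MvPolynomial σ k ⧸ Q) p := by
  obtain ⟨d, hd⟩ := exists_ringKrullDim_quotient_eq (ne_top_of_le_ne_top maxHomIdeal_ne_top hQ)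
  by_contra! h
  have : ∀ n, DepthGE (maxHomIdeal k σ) (MvPolynomial σ k ⧸ Q) n := fun n => by
    induction n with
    | zero => exact depthGE_zero
    | succ n ih => exact not_not.1 fun hn => h n ⟨ih, hn⟩
  have := depthGE_le_ringKrullDim maxHomIdeal_ne_top hQ (this (d + 1))
  rw [hd] at this
  norm_cast at this
  lia

lemma depthQuot_eq_of_hasDepth [Finite σ] {Q : Ideal (MvPolynomial σ k)}
    (hQ : Q ≤ maxHomIdeal k σ) {p : ℕ}
    (h : HasDepth (maxHomIdeal k σ) (MvPolynomial σ k ⧸ Q) p) : depthQuot k Q = p := by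
  have := sInf_nontrivial_localCohomology_quotient maxHomIdeal_ne_top hQ h
  delta depthQuot depthM
  exact this

lemma isCMQuot_iff [Finite σ] {Q : Ideal (MvPolynomial σ k)} (hQ : Q ≤ maxHomIdeal k σ) {d : ℕ}
    (hd : ringKrullDim (MvPolynomial σ k ⧸ Q) = d) :
    IsCMQuot k Q ↔ DepthGE (maxHomIdeal k σ) (MvPolynomial σ k ⧸ Q) d := by
  obtain ⟨p, hp⟩ := exists_hasDepth hQ
  have hle := depthGE_le_ringKrullDim maxHomIdeal_ne_top hQ hp.1
  rw [hd, Nat.cast_le] at hle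
  have hiff : IsCMQuot k Q ↔ ((p : ℕ) : WithBot ℕ∞) = (d : ℕ) := by
    rw [IsCMQuot, depthQuot_eq_of_hasDepth hQ hp, hd]
    rfl
  rw [hiff, Nat.cast_inj]
  exact ⟨fun h => h ▸ hp.1, fun h => le_antisymm hle (hp.le_of_depthGE h)⟩

lemma ringKrullDim_quotient_pow {S : Type*} [CommRing S] (Q : Ideal S) {i : ℕ} (hi : i ≠ 0) :
    ringKrullDim (S ⧸ Q ^ i) = ringKrullDim (S ⧸ Q) := by
  rw [ringKrullDim_quotient, ringKrullDim_quotient, PrimeSpectrum.zeroLocus_pow Q hi]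

lemma extendedSup_pow_inf_le {I : Ideal (MvPolynomial σ k)} {J : Ideal (MvPolynomial τ k)}
    (a b : ℕ) :
    I.map (MvPolynomial.rename (Sum.inl : σ → σ ⊕ τ)) ^ a ⊓
        J.map (MvPolynomial.rename (Sum.inr : τ → σ ⊕ τ)) ^ b ≤
      I.map (MvPolynomial.rename (Sum.inl : σ → σ ⊕ τ)) ^ a *
        J.map (MvPolynomial.rename (Sum.inr : τ → σ ⊕ τ)) ^ b := by
  rw [← Ideal.map_pow, ← Ideal.map_pow]
  exact map_rename_inl_inf_map_rename_inr_le _ _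

lemma extendedSup_pow_pow (I : Ideal (MvPolynomial σ k)) (J : Ideal (MvPolynomial τ k))
    (a b : ℕ) :
    extendedSup (I ^ a) (J ^ b) = I.map (MvPolynomial.rename (Sum.inl : σ → σ ⊕ τ)) ^ a ⊔
      J.map (MvPolynomial.rename (Sum.inr : τ → σ ⊕ τ)) ^ b := by
  rw [extendedSup, Ideal.map_pow, Ideal.map_pow]

lemma isCMQuot_of_depthGE_extendedSup [Finite σ] [Finite τ] {I : Ideal (MvPolynomial σ k)}
    {J : Ideal (MvPolynomial τ k)} (hI : I ≤ maxHomIdeal k σ) (hJ : J ≤ maxHomIdeal k τ) {d e : ℕ}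
    (hd : ringKrullDim (MvPolynomial σ k ⧸ I) = d) (he : ringKrullDim (MvPolynomial τ k ⧸ J) = e)
    (h : DepthGE (maxHomIdeal k (σ ⊕ τ)) (MvPolynomial (σ ⊕ τ) k ⧸ extendedSup I J) (d + e)) :
    IsCMQuot k I ∧ IsCMQuot k J := by
  obtain ⟨p, hp⟩ := exists_hasDepth hI
  obtain ⟨q, hq⟩ := exists_hasDepth hJ
  have hpd := depthGE_le_ringKrullDim maxHomIdeal_ne_top hI hp.1
  have hqe := depthGE_le_ringKrullDim maxHomIdeal_ne_top hJ hq.1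
  rw [hd, Nat.cast_le] at hpd
  rw [he, Nat.cast_le] at hqe
  have hle := (hasDepth_extendedSup hI hJ hp hq).le_of_depthGE h
  rw [isCMQuot_iff hI hd, isCMQuot_iff hJ he]
  exact ⟨hp.1.mono (by lia), hq.1.mono (by lia)⟩

end CohenMacaulay

end DepthCriteria

open PaperHTT in
/-- Proposition 3.7: for `n ≥ 1`, `R/(I+J)^i` is Cohen–Macaulay for all `1 ≤ i ≤ n` if and
only if `A/I^i` and `B/J^i` are Cohen–Macaulay for all `1 ≤ i ≤ n`. -/
theorem cohenMacaulay_powers_iff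
    (k : Type) [Field k] (r s : ℕ)
    (I : Ideal (PA k r)) (J : Ideal (PB k s))
    (hI0 : I ≠ ⊥) (hI1 : I ≠ ⊤) (hIh : IsHomogeneousIdeal k I)
    (hJ0 : J ≠ ⊥) (hJ1 : J ≠ ⊤) (hJh : IsHomogeneousIdeal k J)
    (n : ℕ) (hn : 1 ≤ n) :
    (∀ i : ℕ, 1 ≤ i → i ≤ n → IsCMQuot k ((sumIJ k I J) ^ i)) ↔
      (∀ i : ℕ, 1 ≤ i → i ≤ n → IsCMQuot k (I ^ i) ∧ IsCMQuot k (J ^ i)) := by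
  have hI := le_maxHomIdeal_of_isHomogeneousIdeal hIh hI1
  have hJ := le_maxHomIdeal_of_isHomogeneousIdeal hJh hJ1
  obtain ⟨d, hd⟩ := exists_ringKrullDim_quotient_eq hI1
  obtain ⟨e, he⟩ := exists_ringKrullDim_quotient_eq hJ1
  have hQ : extendedSup I J ≤ maxHomIdeal k (Fin r ⊕ Fin s) :=
    extendedSup_maxHomIdeal (k := k) ▸ extendedSup_mono hI hJ
  have hde : ringKrullDim (_ ⧸ extendedSup I J) = (d + e : ℕ) := by
    rw [ringKrullDim_quotient_extendedSup hI1 hJ1, hd, he, Nat.cast_add]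
  have hpow {σ : Type} {Q : Ideal (MvPolynomial σ k)} (hQ : Q ≤ maxHomIdeal k σ) {i : ℕ}
      (hi : 1 ≤ i) : Q ^ i ≤ maxHomIdeal k σ := (Ideal.pow_le_self (by lia)).trans hQ
  have hdim {σ : Type} {Q : Ideal (MvPolynomial σ k)} {c i : ℕ} (hi : 1 ≤ i)
      (hc : ringKrullDim (_ ⧸ Q) = c) : ringKrullDim (_ ⧸ Q ^ i) = c := by
    rw [ringKrullDim_quotient_pow Q (by lia), hc]
  have hsum (i : ℕ) (hi : 1 ≤ i) : IsCMQuot k (sumIJ k I J ^ i) ↔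
      DepthGE (maxHomIdeal k (Fin r ⊕ Fin s)) (_ ⧸ extendedSup I J ^ i) (d + e) :=
    isCMQuot_iff (hpow hQ hi) (hdim hi hde)
  constructor
  · intro h i hi hin
    have h' (j : ℕ) (hj : 1 ≤ j) (hjn : j ≤ n) := (hsum j hj).1 (h j hj hjn)
    have hA := depthGE_pow_sup extendedSup_pow_inf_le h' hi hin
    have hB := depthGE_pow_sup (I := J.map (MvPolynomial.rename (R := k) Sum.inr))
      (J := I.map (MvPolynomial.rename (R := k) Sum.inl))
      (fun a b => by rw [inf_comm, mul_comm]; exact extendedSup_pow_inf_le b a)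
      (by rwa [sup_comm]) hi hin
    rw [← pow_one (Ideal.map _ J), ← extendedSup_pow_pow] at hA
    rw [sup_comm, ← pow_one (Ideal.map _ I), ← extendedSup_pow_pow] at hB
    exact ⟨(isCMQuot_of_depthGE_extendedSup (hpow hI hi) (hpow hJ le_rfl) (hdim hi hd)
      (hdim le_rfl he) hA).1, (isCMQuot_of_depthGE_extendedSup (hpow hI le_rfl) (hpow hJ hi)
      (hdim le_rfl hd) (hdim hi he) hB).2⟩
  · intro h i hi hin
    rw [hsum i hi]
    refine depthGE_sup_pow extendedSup_pow_inf_le (fun a b ha han hb hbn => ?_) hi hin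
    rw [← extendedSup_pow_pow]
    obtain ⟨p, hp⟩ := exists_hasDepth (hpow hI ha)
    obtain ⟨q, hq⟩ := exists_hasDepth (hpow hJ hb)
    have hdp := hp.le_of_depthGE ((isCMQuot_iff (hpow hI ha) (hdim ha hd)).1 (h a ha han).1)
    have heq := hq.le_of_depthGE ((isCMQuot_iff (hpow hJ hb) (hdim hb he)).1 (h b hb hbn).2)
    exact (hasDepth_extendedSup (hpow hI ha) (hpow hJ hb) hp hq).1.mono (by lia)
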